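/- arXiv:1703.10632 — 4 statements merged into one kernel-verified Lean document; each statement's English description precedes it below -/
import Mathlib

section
/- For all α1, α2 ∈ K, the algebra D_3(α1,α2) is a semisimple ring if and only if (3α1−α2)(α1+α2) ≠ 0; and in that case D_3(α1,α2) is isomorphic as a K-algebra to the product of three copies of the 2×2 matrix algebra M_2(K). -/
noncomputable section

open FreeAlgebra

/-- The defining relations of the PBW deformation `D₃(α₁, α₂)` of the Fomin–Kirillov
algebra `E₃`: with generators `a = ι K 0`, `b = ι K 1`, `c = ι K 2`, the relations are
`a² = b² = c² = α₁`, `ca + bc + ab = α₂` and `cb + ba + ac = α₂`. -/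
inductive D3Rel (K : Type) [Field K] (α1 α2 : K) :
    FreeAlgebra K (Fin 3) → FreeAlgebra K (Fin 3) → Prop
  | ra : D3Rel K α1 α2 (ι K (0 : Fin 3) * ι K (0 : Fin 3))
      (algebraMap K (FreeAlgebra K (Fin 3)) α1)
  | rb : D3Rel K α1 α2 (ι K (1 : Fin 3) * ι K (1 : Fin 3))
      (algebraMap K (FreeAlgebra K (Fin 3)) α1)
  | rc : D3Rel K α1 α2 (ι K (2 : Fin 3) * ι K (2 : Fin 3))
      (algebraMap K (FreeAlgebra K (Fin 3)) α1)
  | r1 : D3Rel K α1 α2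
      (ι K (2 : Fin 3) * ι K (0 : Fin 3) + ι K (1 : Fin 3) * ι K (2 : Fin 3) +
        ι K (0 : Fin 3) * ι K (1 : Fin 3))
      (algebraMap K (FreeAlgebra K (Fin 3)) α2)
  | r2 : D3Rel K α1 α2
      (ι K (2 : Fin 3) * ι K (1 : Fin 3) + ι K (1 : Fin 3) * ι K (0 : Fin 3) +
        ι K (0 : Fin 3) * ι K (2 : Fin 3))
      (algebraMap K (FreeAlgebra K (Fin 3)) α2)

/-- The algebra `D₃(α₁, α₂)`: the quotient of the free algebra `K⟨a,b,c⟩` by the two-sided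
ideal generated by the relations above. -/
abbrev D3 (K : Type) [Field K] (α1 α2 : K) : Type := RingQuot (D3Rel K α1 α2)

namespace D3

variable {K : Type} [Field K] {α1 α2 : K}

/-- The image in `D₃(α₁, α₂)` of the `i`-th generator of the free algebra. -/
def gen (α1 α2 : K) (i : Fin 3) : D3 K α1 α2 :=
  RingQuot.mkAlgHom K (D3Rel K α1 α2) (ι K i)

theorem gen_zero_sq : gen α1 α2 0 * gen α1 α2 0 = algebraMap K _ α1 := by
  simpa [gen] using RingQuot.mkAlgHom_rel K (D3Rel.ra (K := K) (α1 := α1) (α2 := α2))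

theorem gen_one_sq : gen α1 α2 1 * gen α1 α2 1 = algebraMap K _ α1 := by
  simpa [gen] using RingQuot.mkAlgHom_rel K (D3Rel.rb (K := K) (α1 := α1) (α2 := α2))

theorem gen_two_sq : gen α1 α2 2 * gen α1 α2 2 = algebraMap K _ α1 := by
  simpa [gen] using RingQuot.mkAlgHom_rel K (D3Rel.rc (K := K) (α1 := α1) (α2 := α2))

theorem gen_cyclic : gen α1 α2 2 * gen α1 α2 0 + gen α1 α2 1 * gen α1 α2 2 +
    gen α1 α2 0 * gen α1 α2 1 = algebraMap K _ α2 := by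
  simpa [gen] using RingQuot.mkAlgHom_rel K (D3Rel.r1 (K := K) (α1 := α1) (α2 := α2))

theorem gen_anticyclic : gen α1 α2 2 * gen α1 α2 1 + gen α1 α2 1 * gen α1 α2 0 +
    gen α1 α2 0 * gen α1 α2 2 = algebraMap K _ α2 := by
  simpa [gen] using RingQuot.mkAlgHom_rel K (D3Rel.r2 (K := K) (α1 := α1) (α2 := α2))

/-- The universal property of `D₃(α₁, α₂)`. -/
theorem exists_algHom {B : Type} [Ring B] [Algebra K B] (x y z : B)
    (hx : x * x = algebraMap K B α1) (hy : y * y = algebraMap K B α1)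
    (hz : z * z = algebraMap K B α1)
    (h1 : z * x + y * z + x * y = algebraMap K B α2)
    (h2 : z * y + y * x + x * z = algebraMap K B α2) :
    ∃ φ : D3 K α1 α2 →ₐ[K] B,
      φ (gen α1 α2 0) = x ∧ φ (gen α1 α2 1) = y ∧ φ (gen α1 α2 2) = z := by
  refine ⟨RingQuot.liftAlgHom K ⟨FreeAlgebra.lift K ![x, y, z], ?_⟩, ?_, ?_, ?_⟩
  · rintro _ _ (_ | _ | _ | _ | _) <;> simp [*]
  all_goals simp [gen]

theorem induction_mul_right {S : Submodule K (D3 K α1 α2)} (h1 : 1 ∈ S)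
    (h : ∀ i, ∀ x ∈ S, x * gen α1 α2 i ∈ S) : S = ⊤ := by
  have key : ∀ p : FreeAlgebra K (Fin 3), ∀ x ∈ S,
      x * RingQuot.mkAlgHom K (D3Rel K α1 α2) p ∈ S := by
    intro p
    induction p using FreeAlgebra.induction with
    | grade0 r =>
      intro x hx
      rw [AlgHom.commutes, ← Algebra.commutes, ← Algebra.smul_def]
      exact S.smul_mem r hx
    | grade1 i => exact h i
    | mul p q hp hq =>
      intro x hx
      rw [map_mul, ← mul_assoc]
      exact hq _ (hp x hx)
    | add p q hp hq =>
      intro x hx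
      rw [map_add, mul_add]
      exact S.add_mem (hp x hx) (hq x hx)
  refine (Submodule.eq_top_iff').2 fun d => ?_
  obtain ⟨p, rfl⟩ := RingQuot.mkAlgHom_surjective K (D3Rel K α1 α2) d
  simpa using key p 1 h1

theorem gen_braid : gen α1 α2 1 * gen α1 α2 0 * gen α1 α2 1 =
    gen α1 α2 0 * gen α1 α2 1 * gen α1 α2 0 + α2 • gen α1 α2 1 - α2 • gen α1 α2 0 := by
  have ha := gen_zero_sq (α1 := α1) (α2 := α2)
  have hb := gen_one_sq (α1 := α1) (α2 := α2)
  have h := gen_cyclic (α1 := α1) (α2 := α2)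
  have ha' := Algebra.commutes α1 (gen α1 α2 2)
  have hb' := Algebra.commutes α2 (gen α1 α2 1)
  rw [Algebra.smul_def, Algebra.smul_def]
  generalize gen α1 α2 0 = a at *
  generalize gen α1 α2 1 = b at *
  generalize gen α1 α2 2 = c at *
  rw [hb', ← h]
  have e1 : c * (a * a) = b * b * c := by rw [ha, hb, ha']
  have e2 : b * (c * a + b * c + a * b) - (c * a + b * c + a * b) * a =
      b * b * c - c * (a * a) + b * a * b - a * b * a := by noncomm_ring
  rw [e1, sub_self, zero_add] at e2
  rw [h] at e2 ⊢
  rw [add_sub_assoc, e2]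
  noncomm_ring

/-- The words `1, a, b, ab, ba, aba` spanning the subalgebra generated by `a` and `b`. -/
def word (α1 α2 : K) : Fin 6 → D3 K α1 α2 :=
  ![1, gen α1 α2 0, gen α1 α2 1, gen α1 α2 0 * gen α1 α2 1, gen α1 α2 1 * gen α1 α2 0,
    gen α1 α2 0 * gen α1 α2 1 * gen α1 α2 0]

theorem word_mem (i : Fin 6) : word α1 α2 i ∈ Submodule.span K (Set.range (word α1 α2)) :=
  Submodule.subset_span ⟨i, rfl⟩

theorem mul_mem_of_word {d x : D3 K α1 α2} {S : Submodule K (D3 K α1 α2)}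
    (hx : x ∈ Submodule.span K (Set.range (word α1 α2)))
    (h : ∀ i, word α1 α2 i * d ∈ S) : x * d ∈ S := by
  induction hx using Submodule.span_induction with
  | mem x hx => obtain ⟨i, rfl⟩ := hx; exact h i
  | zero => simp
  | add x y _ _ hx hy => rw [add_mul]; exact S.add_mem hx hy
  | smul r x _ hx => rw [smul_mul_assoc]; exact S.smul_mem r hx

theorem span_word_mul_gen_zero {x : D3 K α1 α2}
    (hx : x ∈ Submodule.span K (Set.range (word α1 α2))) :
    x * gen α1 α2 0 ∈ Submodule.span K (Set.range (word α1 α2)) := by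
  have ha : ∀ y : D3 K α1 α2, y * gen α1 α2 0 * gen α1 α2 0 = α1 • y := fun y => by
    rw [mul_assoc, gen_zero_sq, ← Algebra.commutes, Algebra.smul_def]
  have w := word_mem (α1 := α1) (α2 := α2)
  refine mul_mem_of_word hx fun i => ?_
  fin_cases i
  · simpa [word] using w 1
  · have := Submodule.smul_mem _ α1 (w 0)
    simpa [word, gen_zero_sq, Algebra.algebraMap_eq_smul_one] using this
  · exact w 4
  · exact w 5
  · have := Submodule.smul_mem _ α1 (w 2)
    simpa [word, ha] using this
  · have := Submodule.smul_mem _ α1 (w 3)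
    simpa [word, ha] using this

theorem span_word_mul_gen_one {x : D3 K α1 α2}
    (hx : x ∈ Submodule.span K (Set.range (word α1 α2))) :
    x * gen α1 α2 1 ∈ Submodule.span K (Set.range (word α1 α2)) := by
  have hb : ∀ y : D3 K α1 α2, y * gen α1 α2 1 * gen α1 α2 1 = α1 • y := fun y => by
    rw [mul_assoc, gen_one_sq, ← Algebra.commutes, Algebra.smul_def]
  have w := word_mem (α1 := α1) (α2 := α2)
  refine mul_mem_of_word hx fun i => ?_
  fin_cases i
  · simpa [word] using w 2
  · exact w 3
  · have := Submodule.smul_mem _ α1 (w 0)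
    simpa [word, gen_one_sq, Algebra.algebraMap_eq_smul_one] using this
  · have := Submodule.smul_mem _ α1 (w 1)
    simpa [word, hb] using this
  · have := Submodule.sub_mem _ (Submodule.add_mem _ (w 5) (Submodule.smul_mem _ α2 (w 2)))
      (Submodule.smul_mem _ α2 (w 1))
    simpa [word, gen_braid] using this
  · have key : gen α1 α2 0 * gen α1 α2 1 * gen α1 α2 0 * gen α1 α2 1 =
        α1 • (gen α1 α2 1 * gen α1 α2 0) + α2 • (gen α1 α2 0 * gen α1 α2 1) -
          (α2 * α1) • (1 : D3 K α1 α2) := by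
      rw [mul_assoc (gen α1 α2 0), mul_assoc (gen α1 α2 0), gen_braid, mul_sub, mul_add,
        ← mul_assoc, ← mul_assoc, gen_zero_sq, mul_smul_comm, mul_smul_comm, gen_zero_sq,
        mul_assoc, ← Algebra.smul_def, Algebra.algebraMap_eq_smul_one, smul_smul]
    have := Submodule.sub_mem _ (Submodule.add_mem _ (Submodule.smul_mem _ α1 (w 4))
      (Submodule.smul_mem _ α2 (w 3))) (Submodule.smul_mem _ (α2 * α1) (w 0))
    simpa [word, key] using this

theorem span_word_sup_eq_top :
    Submodule.span K (Set.range (word α1 α2)) ⊔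
      (Submodule.span K (Set.range (word α1 α2))).map
        (LinearMap.mulRight K (gen α1 α2 2)) = ⊤ := by
  set A := Submodule.span K (Set.range (word α1 α2))
  have hmap : ∀ x ∈ A, x * gen α1 α2 2 ∈ A ⊔ A.map (LinearMap.mulRight K (gen α1 α2 2)) :=
    fun x hx => Submodule.mem_sup_right ⟨x, hx, rfl⟩
  have h20 : ∀ x : D3 K α1 α2, x * gen α1 α2 2 * gen α1 α2 0 =
      α2 • x - x * gen α1 α2 1 * gen α1 α2 2 - x * gen α1 α2 0 * gen α1 α2 1 := fun x => by
    rw [Algebra.smul_def, Algebra.commutes, ← gen_cyclic]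
    noncomm_ring
  have h21 : ∀ x : D3 K α1 α2, x * gen α1 α2 2 * gen α1 α2 1 =
      α2 • x - x * gen α1 α2 1 * gen α1 α2 0 - x * gen α1 α2 0 * gen α1 α2 2 := fun x => by
    rw [Algebra.smul_def, Algebra.commutes, ← gen_anticyclic]
    noncomm_ring
  have h22 : ∀ x : D3 K α1 α2, x * gen α1 α2 2 * gen α1 α2 2 = α1 • x := fun x => by
    rw [mul_assoc, gen_two_sq, ← Algebra.commutes, Algebra.smul_def]
  refine induction_mul_right (Submodule.mem_sup_left (word_mem 0)) fun i x hx => ?_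
  obtain ⟨y, hy, _, ⟨z, hz, rfl⟩, rfl⟩ := Submodule.mem_sup.1 hx
  rw [add_mul, LinearMap.mulRight_apply]
  have hz0 := span_word_mul_gen_zero hz
  have hz1 := span_word_mul_gen_one hz
  refine Submodule.add_mem _ ?_ ?_
  · fin_cases i
    · exact Submodule.mem_sup_left (span_word_mul_gen_zero hy)
    · exact Submodule.mem_sup_left (span_word_mul_gen_one hy)
    · exact hmap y hy
  · fin_cases i
    · exact h20 z ▸ Submodule.sub_mem _ (Submodule.sub_mem _
        (Submodule.mem_sup_left (A.smul_mem _ hz)) (hmap _ hz1))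
        (Submodule.mem_sup_left (span_word_mul_gen_one hz0))
    · exact h21 z ▸ Submodule.sub_mem _ (Submodule.sub_mem _
        (Submodule.mem_sup_left (A.smul_mem _ hz))
        (Submodule.mem_sup_left (span_word_mul_gen_zero hz1))) (hmap _ hz0)
    · exact h22 z ▸ Submodule.mem_sup_left (A.smul_mem _ hz)

instance finite : Module.Finite K (D3 K α1 α2) := by
  rw [Module.finite_def, ← span_word_sup_eq_top]
  have hfg := Submodule.fg_span (R := K) (Set.finite_range (word α1 α2))
  exact hfg.sup (hfg.map _)

theorem finrank_le : Module.finrank K (D3 K α1 α2) ≤ 12 := by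
  have h6 : Module.finrank K (Submodule.span K (Set.range (word α1 α2))) ≤ 6 :=
    finrank_range_le_card (word α1 α2)
  have := Submodule.finrank_add_le_finrank_add_finrank
    (Submodule.span K (Set.range (word α1 α2)))
    ((Submodule.span K (Set.range (word α1 α2))).map (LinearMap.mulRight K (gen α1 α2 2)))
  have hm := Submodule.finrank_map_le (LinearMap.mulRight K (gen α1 α2 2))
    (Submodule.span K (Set.range (word α1 α2)))
  rw [span_word_sup_eq_top, finrank_top] at this
  omega

/-- A semisimple ring is von Neumann regular. -/
theorem exists_eq_mul_mul {R : Type} [Ring R] [IsSemisimpleRing R] (x : R) :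
    ∃ y, x * y * x = x := by
  obtain ⟨e, he, h⟩ := IsSemisimpleRing.ideal_eq_span_idempotent (Ideal.span {x})
  obtain ⟨y, hy⟩ := Ideal.mem_span_singleton'.1 (h ▸ Ideal.mem_span_singleton_self e)
  obtain ⟨z, hz⟩ := Ideal.mem_span_singleton'.1 (h ▸ Ideal.mem_span_singleton_self x)
  refine ⟨y, ?_⟩
  rw [mul_assoc, hy, ← hz, mul_assoc, he.eq]

/-- A ring with an upper triangular representation of degree two attaining a nonzero strictly
upper triangular matrix is not semisimple. -/
theorem not_isSemisimpleRing_of_upper {R : Type} [Ring R]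
    (φ : R →+* Matrix (Fin 2) (Fin 2) K) (hφ : ∀ r, φ r 1 0 = 0) (x : R)
    (hx : φ x = !![0, 1; 0, 0]) : ¬ IsSemisimpleRing R := by
  intro _
  obtain ⟨y, hy⟩ := exists_eq_mul_mul x
  have h := congrFun (congrFun (congrArg φ hy) 0) 1
  rw [map_mul, map_mul, hx] at h
  rw [Matrix.eta_fin_two (φ y), hφ] at h
  simp at h

theorem not_isSemisimpleRing_of_gen (φ : D3 K α1 α2 →ₐ[K] Matrix (Fin 2) (Fin 2) K)
    (hφ : ∀ i, φ (gen α1 α2 i) 1 0 = 0) (x : D3 K α1 α2) (hx : φ x = !![0, 1; 0, 0]) :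
    ¬ IsSemisimpleRing (D3 K α1 α2) := by
  let S : Submodule K (D3 K α1 α2) := LinearMap.ker
    (LinearMap.comp (Matrix.entryLinearMap K K (1 : Fin 2) (0 : Fin 2)) φ.toLinearMap)
  have hS : ∀ d, d ∈ S ↔ φ d 1 0 = 0 := fun d => Iff.rfl
  have htop : S = ⊤ := induction_mul_right (by simp [hS]) fun i d hd => by
    rw [hS] at hd ⊢
    simp [Matrix.mul_apply, Fin.sum_univ_two, hφ, hd]
  refine not_isSemisimpleRing_of_upper φ.toRingHom (fun r => ?_) x hx
  exact (hS r).1 (htop ▸ Submodule.mem_top)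

theorem not_isSemisimpleRing_of_add_eq_zero [IsAlgClosed K] (h : α1 + α2 = 0) :
    ¬ IsSemisimpleRing (D3 K α1 α2) := by
  obtain ⟨s, hs⟩ := IsAlgClosed.exists_pow_nat_eq α1 (n := 2) (by norm_num)
  obtain rfl : α2 = -α1 := by linear_combination h
  subst hs
  obtain ⟨φ, h0, h1, h2⟩ := exists_algHom (α1 := s ^ 2) (α2 := -s ^ 2)
    !![s, 0; 0, -s] !![s, 0; 0, -s] !![-s, 1; 0, s]
    (by ext i j; fin_cases i <;> fin_cases j <;> simp [Matrix.algebraMap_matrix_apply] <;> ring)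
    (by ext i j; fin_cases i <;> fin_cases j <;> simp [Matrix.algebraMap_matrix_apply] <;> ring)
    (by ext i j; fin_cases i <;> fin_cases j <;> simp [Matrix.algebraMap_matrix_apply] <;> ring)
    (by ext i j; fin_cases i <;> fin_cases j <;> simp [Matrix.algebraMap_matrix_apply] <;> ring)
    (by ext i j; fin_cases i <;> fin_cases j <;> simp [Matrix.algebraMap_matrix_apply] <;> ring)
  refine not_isSemisimpleRing_of_gen φ (fun i => ?_)
    (gen _ _ 0 + gen _ _ 2) ?_
  · fin_cases i <;> simp [h0, h1, h2]
  · simp [h0, h2]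

theorem not_isSemisimpleRing_of_three_mul_eq [IsAlgClosed K] (h : 3 * α1 - α2 = 0) :
    ¬ IsSemisimpleRing (D3 K α1 α2) := by
  obtain ⟨s, hs⟩ := IsAlgClosed.exists_pow_nat_eq α1 (n := 2) (by norm_num)
  obtain rfl : α2 = 3 * α1 := by linear_combination -h
  subst hs
  obtain ⟨φ, h0, h1, h2⟩ := exists_algHom (α1 := s ^ 2) (α2 := 3 * s ^ 2)
    !![s, 0; 0, -s] !![s, 1; 0, -s] !![s, 0; 0, -s]
    (by ext i j; fin_cases i <;> fin_cases j <;> simp [Matrix.algebraMap_matrix_apply] <;> ring)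
    (by ext i j; fin_cases i <;> fin_cases j <;> simp [Matrix.algebraMap_matrix_apply] <;> ring)
    (by ext i j; fin_cases i <;> fin_cases j <;> simp [Matrix.algebraMap_matrix_apply] <;> ring)
    (by ext i j; fin_cases i <;> fin_cases j <;> simp [Matrix.algebraMap_matrix_apply] <;> ring)
    (by ext i j; fin_cases i <;> fin_cases j <;> simp [Matrix.algebraMap_matrix_apply] <;> ring)
  refine not_isSemisimpleRing_of_gen φ (fun i => ?_)
    (gen _ _ 1 - gen _ _ 0) ?_
  · fin_cases i <;> simp [h0, h1, h2]
  · rw [map_sub, h0, h1]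
    ext i j
    fin_cases i <;> fin_cases j <;> simp

theorem subalgebra_eq_top {s k : K} (hk : k ≠ 0) (hs : k - 4 * s ^ 2 ≠ 0)
    {R : Subalgebra K (Matrix (Fin 2) (Fin 2) K)} (hX : !![s, 1; 0, -s] ∈ R)
    (hY : !![-s, 0; k, s] ∈ R) : R = ⊤ := by
  have h11 : !![1, 0; 0, 0] ∈ R := by
    have : (!![1, 0; 0, 0] : Matrix (Fin 2) (Fin 2) K) = (k - 4 * s ^ 2)⁻¹ •
        (!![s, 1; 0, -s] * !![-s, 0; k, s] - s • !![s, 1; 0, -s] + s • !![-s, 0; k, s]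
          - s ^ 2 • 1) := by
      ext i j
      fin_cases i <;> fin_cases j <;> simp [eq_inv_mul_iff_mul_eq₀ hs] <;> ring
    rw [this]
    exact R.smul_mem (R.sub_mem (R.add_mem (R.sub_mem (R.mul_mem hX hY) (R.smul_mem hX _))
      (R.smul_mem hY _)) (R.smul_mem R.one_mem _)) _
  have h12 : !![0, 1; 0, 0] ∈ R := by
    have : (!![0, 1; 0, 0] : Matrix (Fin 2) (Fin 2) K) =
        !![1, 0; 0, 0] * !![s, 1; 0, -s] - s • !![1, 0; 0, 0] := by
      ext i j
      fin_cases i <;> fin_cases j <;> simp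
    rw [this]
    exact R.sub_mem (R.mul_mem h11 hX) (R.smul_mem h11 _)
  have h21 : !![0, 0; 1, 0] ∈ R := by
    have : (!![0, 0; 1, 0] : Matrix (Fin 2) (Fin 2) K) =
        k⁻¹ • (!![-s, 0; k, s] * !![1, 0; 0, 0] + s • !![1, 0; 0, 0]) := by
      ext i j
      fin_cases i <;> fin_cases j <;> simp [hk]
    rw [this]
    exact R.smul_mem (R.add_mem (R.mul_mem hY h11) (R.smul_mem h11 _)) _
  rw [eq_top_iff]
  intro m _
  have : m = m 0 0 • !![1, 0; 0, 0] + m 0 1 • !![0, 1; 0, 0] + m 1 0 • !![0, 0; 1, 0] +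
      m 1 1 • (1 - !![1, 0; 0, 0]) := by
    ext i j
    fin_cases i <;> fin_cases j <;> simp
  rw [this]
  exact R.add_mem (R.add_mem (R.add_mem (R.smul_mem h11 _) (R.smul_mem h12 _))
    (R.smul_mem h21 _)) (R.smul_mem (R.sub_mem R.one_mem h11) _)

theorem nonempty_algEquiv [IsAlgClosed K] (h : (3 * α1 - α2) * (α1 + α2) ≠ 0) :
    Nonempty (D3 K α1 α2 ≃ₐ[K]
      (Matrix (Fin 2) (Fin 2) K × Matrix (Fin 2) (Fin 2) K × Matrix (Fin 2) (Fin 2) K)) := by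
  obtain ⟨s, hs⟩ := IsAlgClosed.exists_pow_nat_eq α1 (n := 2) (by norm_num)
  have hl : 3 * α1 - α2 ≠ 0 := left_ne_zero_of_mul h
  have hk : α1 + α2 ≠ 0 := right_ne_zero_of_mul h
  have hks : (α1 + α2) - 4 * s ^ 2 ≠ 0 := by
    rw [hs]
    exact fun h0 => hl (by linear_combination -h0)
  obtain ⟨X, hXdef⟩ : ∃ X : Matrix (Fin 2) (Fin 2) K, X = !![s, 1; 0, -s] := ⟨_, rfl⟩
  obtain ⟨Y, hYdef⟩ : ∃ Y : Matrix (Fin 2) (Fin 2) K, Y = !![-s, 0; α1 + α2, s] := ⟨_, rfl⟩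
  have hX : X * X = algebraMap K _ α1 := by
    rw [hXdef, ← hs]
    ext i j
    fin_cases i <;> fin_cases j <;> simp [Matrix.algebraMap_matrix_apply] <;> ring
  have hY : Y * Y = algebraMap K _ α1 := by
    rw [hYdef, ← hs]
    ext i j
    fin_cases i <;> fin_cases j <;> simp [Matrix.algebraMap_matrix_apply] <;> ring
  have hXY : X * Y + Y * X = algebraMap K _ (α2 - α1) := by
    rw [hXdef, hYdef, ← hs]
    ext i j
    fin_cases i <;> fin_cases j <;> simp [Matrix.algebraMap_matrix_apply] <;> ring
  have hXXY : X * X + X * Y + Y * X = algebraMap K _ α2 := by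
    rw [add_assoc, hXY, hX, ← map_add, add_sub_cancel]
  have hsq : (X - Y) * (X - Y) = algebraMap K _ (3 * α1 - α2) := by
    have : (X - Y) * (X - Y) = X * X + Y * Y - (X * Y + Y * X) := by noncomm_ring
    rw [this, hX, hY, hXY, ← map_add, ← map_sub]
    congr 1
    ring
  have hsq' : (Y - X) * (Y - X) = algebraMap K _ (3 * α1 - α2) := by
    rw [← hsq]
    noncomm_ring
  have hsurj : ∀ f : D3 K α1 α2 →ₐ[K] Matrix (Fin 2) (Fin 2) K, (∃ d, f d = X) →
      (∃ d, f d = Y) → Function.Surjective f := by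
    intro f hfX hfY
    rw [← AlgHom.range_eq_top]
    exact subalgebra_eq_top hk hks (hXdef ▸ hfX) (hYdef ▸ hfY)
  obtain ⟨f, hf0, hf1, hf2⟩ := exists_algHom (α1 := α1) (α2 := α2) X X Y hX hX hY
    (by rw [← hXXY]; abel) (by rw [← hXXY]; abel)
  obtain ⟨g, hg0, hg1, hg2⟩ := exists_algHom (α1 := α1) (α2 := α2) X Y X hX hY hX
    (by rw [← hXXY]; abel) (by rw [← hXXY]; abel)
  obtain ⟨t, ht0, ht1, ht2⟩ := exists_algHom (α1 := α1) (α2 := α2) Y X X hY hX hX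
    (by rw [← hXXY]; abel) hXXY
  let F := f.prod (g.prod t)
  have hF : Function.Surjective F := by
    rintro ⟨p, q, r⟩
    obtain ⟨p, rfl⟩ := hsurj f ⟨_, hf0⟩ ⟨_, hf2⟩ p
    obtain ⟨q, rfl⟩ := hsurj g ⟨_, hg0⟩ ⟨_, hg1⟩ q
    obtain ⟨r, rfl⟩ := hsurj t ⟨_, ht1⟩ ⟨_, ht0⟩ r
    obtain ⟨μ, hμ⟩ : ∃ μ : K, μ * ((3 * α1 - α2) * (3 * α1 - α2)) = 1 :=
      ⟨_, inv_mul_cancel₀ (mul_ne_zero hl hl)⟩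
    let x := (gen α1 α2 0 - gen α1 α2 1) * (gen α1 α2 0 - gen α1 α2 1)
    let y := (gen α1 α2 0 - gen α1 α2 2) * (gen α1 α2 0 - gen α1 α2 2)
    let z := (gen α1 α2 1 - gen α1 α2 2) * (gen α1 α2 1 - gen α1 α2 2)
    have hμ' : ∀ M : Matrix (Fin 2) (Fin 2) K, μ • (algebraMap K _ (3 * α1 - α2) *
        algebraMap K _ (3 * α1 - α2) * M) = M := fun M => by
      rw [← map_mul, ← Algebra.smul_def, smul_smul, hμ, one_smul]
    refine ⟨μ • (y * z * p) + μ • (x * z * q) + μ • (x * y * r), ?_⟩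
    refine Prod.ext ?_ (Prod.ext ?_ ?_)
    · change f _ = _
      simp only [x, y, z, map_add, map_smul, map_mul, map_sub f, hf0, hf1, hf2, hsq,
        sub_self, mul_zero, zero_mul, smul_zero, add_zero, hμ']
    · change g _ = _
      simp only [x, y, z, map_add, map_smul, map_mul, map_sub g, hg0, hg1, hg2, hsq, hsq',
        sub_self, mul_zero, zero_mul, smul_zero, add_zero, zero_add, hμ']
    · change t _ = _
      simp only [x, y, z, map_add, map_smul, map_mul, map_sub t, ht0, ht1, ht2, hsq',
        sub_self, mul_zero, zero_mul, smul_zero, add_zero, zero_add, hμ']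
  have hdim : Module.finrank K (Matrix (Fin 2) (Fin 2) K × Matrix (Fin 2) (Fin 2) K ×
      Matrix (Fin 2) (Fin 2) K) = 12 := by
    simp [Module.finrank_prod, Module.finrank_matrix]
  have hle := LinearMap.finrank_le_finrank_of_surjective (f := F.toLinearMap) hF
  have hinj : Function.Injective F.toLinearMap :=
    (LinearMap.injective_iff_surjective_of_finrank_eq_finrank
      (le_antisymm (hdim ▸ finrank_le) hle)).2 hF
  exact ⟨AlgEquiv.ofBijective F ⟨hinj, hF⟩⟩

end D3

theorem D3_semisimple_iff (K : Type) [Field K] [IsAlgClosed K] (hchar : ringChar K ≠ 2) :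
    ∀ α1 α2 : K,
      (IsSemisimpleRing (D3 K α1 α2) ↔ (3 * α1 - α2) * (α1 + α2) ≠ 0) ∧
      ((3 * α1 - α2) * (α1 + α2) ≠ 0 →
        Nonempty (D3 K α1 α2 ≃ₐ[K]
          (Matrix (Fin 2) (Fin 2) K × Matrix (Fin 2) (Fin 2) K × Matrix (Fin 2) (Fin 2) K))) := by
  intro α1 α2
  refine ⟨⟨fun hss h => ?_, fun h => ?_⟩, D3.nonempty_algEquiv⟩
  · rcases mul_eq_zero.1 h with h | h
    · exact D3.not_isSemisimpleRing_of_three_mul_eq h hss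
    · exact D3.not_isSemisimpleRing_of_add_eq_zero h hss
  · obtain ⟨e⟩ := D3.nonempty_algEquiv h
    exact e.symm.toRingEquiv.isSemisimpleRing
end
end

section
/- Let α1, α2 ∈ K and set β = 3α1 − α2. In the algebra 𝒦(α1,α2) the following relations hold: y·a = c·y, y·b = a·y, y·c = b·y, b·a·b − a·b·a = α2·(b−a), and (b−a)³ = β·(b−a). In particular, y³ is a central element of 𝒦(α1,α2). -/
noncomputable section

open FreeAlgebra

/-- The defining relations of the algebra `𝒦(α₁, α₂)`: with generators `a = ι K 0`,
`b = ι K 1`, `c = ι K 2`, `y = ι K 3`, the relations are `a² = b² = c² = α₁`,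
`ab + bc + ca = α₂` and `ac + cb + ba = α₂ + y`. -/
inductive KRel (K : Type) [Field K] (α1 α2 : K) :
    FreeAlgebra K (Fin 4) → FreeAlgebra K (Fin 4) → Prop
  | ra : KRel K α1 α2 (ι K (0 : Fin 4) * ι K (0 : Fin 4))
      (algebraMap K (FreeAlgebra K (Fin 4)) α1)
  | rb : KRel K α1 α2 (ι K (1 : Fin 4) * ι K (1 : Fin 4))
      (algebraMap K (FreeAlgebra K (Fin 4)) α1)
  | rc : KRel K α1 α2 (ι K (2 : Fin 4) * ι K (2 : Fin 4))
      (algebraMap K (FreeAlgebra K (Fin 4)) α1)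
  | r1 : KRel K α1 α2
      (ι K (0 : Fin 4) * ι K (1 : Fin 4) + ι K (1 : Fin 4) * ι K (2 : Fin 4) +
        ι K (2 : Fin 4) * ι K (0 : Fin 4))
      (algebraMap K (FreeAlgebra K (Fin 4)) α2)
  | r2 : KRel K α1 α2
      (ι K (0 : Fin 4) * ι K (2 : Fin 4) + ι K (2 : Fin 4) * ι K (1 : Fin 4) +
        ι K (1 : Fin 4) * ι K (0 : Fin 4))
      (algebraMap K (FreeAlgebra K (Fin 4)) α2 + ι K (3 : Fin 4))

/-- The algebra `𝒦(α₁, α₂)`: the quotient of the free algebra `K⟨a,b,c,y⟩` by the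
two-sided ideal generated by the relations above. -/
abbrev KAlg (K : Type) [Field K] (α1 α2 : K) : Type := RingQuot (KRel K α1 α2)

/-- The generator `a` of `𝒦(α₁, α₂)`. -/
def Ka (K : Type) [Field K] (α1 α2 : K) : KAlg K α1 α2 :=
  RingQuot.mkAlgHom K (KRel K α1 α2) (ι K (0 : Fin 4))

/-- The generator `b` of `𝒦(α₁, α₂)`. -/
def Kb (K : Type) [Field K] (α1 α2 : K) : KAlg K α1 α2 :=
  RingQuot.mkAlgHom K (KRel K α1 α2) (ι K (1 : Fin 4))

/-- The generator `c` of `𝒦(α₁, α₂)`. -/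
def Kc (K : Type) [Field K] (α1 α2 : K) : KAlg K α1 α2 :=
  RingQuot.mkAlgHom K (KRel K α1 α2) (ι K (2 : Fin 4))

/-- The generator `y` of `𝒦(α₁, α₂)`. -/
def Ky (K : Type) [Field K] (α1 α2 : K) : KAlg K α1 α2 :=
  RingQuot.mkAlgHom K (KRel K α1 α2) (ι K (3 : Fin 4))

/-- The defining relations of the algebra `𝒦(α₁, α₂, α₃)`: those of `𝒦(α₁, α₂)`
together with `y³ = α₃`. -/
inductive KRel3 (K : Type) [Field K] (α1 α2 α3 : K) :
    FreeAlgebra K (Fin 4) → FreeAlgebra K (Fin 4) → Prop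
  | base {x y : FreeAlgebra K (Fin 4)} : KRel K α1 α2 x y → KRel3 K α1 α2 α3 x y
  | r3 : KRel3 K α1 α2 α3 (ι K (3 : Fin 4) ^ 3) (algebraMap K (FreeAlgebra K (Fin 4)) α3)

/-- The algebra `𝒦(α₁, α₂, α₃) = 𝒦(α₁, α₂)/(y³ - α₃)`. -/
abbrev KAlg3 (K : Type) [Field K] (α1 α2 α3 : K) : Type := RingQuot (KRel3 K α1 α2 α3)

/-- The generator `a` of `𝒦(α₁, α₂, α₃)`. -/
def K3a (K : Type) [Field K] (α1 α2 α3 : K) : KAlg3 K α1 α2 α3 :=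
  RingQuot.mkAlgHom K (KRel3 K α1 α2 α3) (ι K (0 : Fin 4))

/-- The generator `b` of `𝒦(α₁, α₂, α₃)`. -/
def K3b (K : Type) [Field K] (α1 α2 α3 : K) : KAlg3 K α1 α2 α3 :=
  RingQuot.mkAlgHom K (KRel3 K α1 α2 α3) (ι K (1 : Fin 4))

/-- The generator `c` of `𝒦(α₁, α₂, α₃)`. -/
def K3c (K : Type) [Field K] (α1 α2 α3 : K) : KAlg3 K α1 α2 α3 :=
  RingQuot.mkAlgHom K (KRel3 K α1 α2 α3) (ι K (2 : Fin 4))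

/-- The generator `y` of `𝒦(α₁, α₂, α₃)`. -/
def K3y (K : Type) [Field K] (α1 α2 α3 : K) : KAlg3 K α1 α2 α3 :=
  RingQuot.mkAlgHom K (KRel3 K α1 α2 α3) (ι K (3 : Fin 4))

section Relations

variable {K A : Type*} [Field K] [Ring A] [Algebra K A] {r s : K} {u v w z : A}

/-- If `uv + vw + wu` is a scalar and `u² = w²` is a scalar, then `u` and `w` satisfy a
deformed braid relation. -/
theorem mul_mul_sub_mul_mul_eq_smul (hu : u * u = algebraMap K A r)
    (hw : w * w = algebraMap K A r) (h : u * v + v * w + w * u = algebraMap K A s) :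
    u * w * u - w * u * w = s • (u - w) := by
  have h1 : u * u * v + u * v * w + u * w * u = s • u := by
    have := congrArg (u * ·) h
    simpa only [mul_add, ← mul_assoc, Algebra.smul_def, Algebra.commutes] using this
  have h2 : u * v * w + v * (w * w) + w * u * w = s • w := by
    have := congrArg (· * w) h
    simpa only [add_mul, mul_assoc, Algebra.smul_def] using this
  rw [hu] at h1
  rw [hw, ← Algebra.commutes] at h2
  rw [smul_sub, ← h1, ← h2]
  abel

/-- Conjugation by `z` sends `u` to `w`, given the braid relation between `u` and `w`. -/
theorem mul_eq_mul_of_eq_add (hu : u * u = algebraMap K A r)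
    (hw : w * w = algebraMap K A r) (h : u * w + w * v + v * u = algebraMap K A s + z)
    (hb : u * w * u - w * u * w = s • (u - w)) : z * u = w * z := by
  have hz : z = u * w + w * v + v * u - algebraMap K A s := by rw [h]; abel
  have h1 : z * u = u * w * u + w * v * u + v * (u * u) - s • u := by
    rw [hz, Algebra.smul_def]
    noncomm_ring
  have h2 : w * z = w * u * w + w * w * v + w * v * u - s • w := by
    rw [hz, Algebra.smul_def, Algebra.commutes]
    noncomm_ring
  rw [smul_sub] at hb
  rw [h1, h2, hu, hw, ← Algebra.commutes r v, ← sub_eq_zero]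
  rw [← sub_eq_zero] at hb
  rw [← hb]
  abel

/-- The cube of a difference of two elements with the same scalar square. -/
theorem sub_pow_three_eq_smul (hu : u * u = algebraMap K A r)
    (hv : v * v = algebraMap K A r) (hb : v * u * v - u * v * u = s • (v - u)) :
    (v - u) ^ 3 = (3 * r - s) • (v - u) := by
  have h : (v - u) ^ 3 = v * v * v - v * v * u - (v * u * v - u * v * u) - u * (v * v)
      + v * (u * u) + u * u * v - u * u * u := by
    noncomm_ring
  rw [h, hb, hu, hv, ← Algebra.commutes r u, ← Algebra.commutes r v]
  simp only [← Algebra.smul_def]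
  module

/-- If `z` permutes `u`, `w`, `v` cyclically by conjugation, its cube commutes with `u`. -/
theorem commute_pow_three (h1 : z * u = w * z) (h2 : z * w = v * z) (h3 : z * v = u * z) :
    Commute (z ^ 3) u := by
  have hc : SemiconjBy (z * z * z) u u :=
    (SemiconjBy.mul_left (show SemiconjBy z v u from h3) (show SemiconjBy z w v from h2)).mul_left
      (show SemiconjBy z u w from h1)
  rwa [pow_three', Commute]

end Relations

/-- An element commuting with the four generators is central. -/
theorem KAlg_commute {K : Type} [Field K] {α1 α2 : K} {t : KAlg K α1 α2}
    (ha : Commute t (Ka K α1 α2)) (hb : Commute t (Kb K α1 α2))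
    (hc : Commute t (Kc K α1 α2)) (hy : Commute t (Ky K α1 α2)) (x : KAlg K α1 α2) :
    Commute t x := by
  obtain ⟨f, rfl⟩ := RingQuot.mkAlgHom_surjective K (KRel K α1 α2) x
  induction f using FreeAlgebra.induction with
  | grade0 k => rw [AlgHom.commutes]; exact (Algebra.commutes k t).symm
  | grade1 i => fin_cases i <;> assumption
  | mul f g hf hg => rw [map_mul]; exact hf.mul_right hg
  | add f g hf hg => rw [map_add]; exact hf.add_right hg

theorem KAlg_rels (K : Type) [Field K] [IsAlgClosed K]
    (h2 : ringChar K ≠ 2) (h3 : ringChar K ≠ 3) (α1 α2 : K) :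
    let a := Ka K α1 α2
    let b := Kb K α1 α2
    let c := Kc K α1 α2
    let y := Ky K α1 α2
    let β := 3 * α1 - α2
    y * a = c * y ∧ y * b = a * y ∧ y * c = b * y ∧
    b * a * b - a * b * a = α2 • (b - a) ∧
    (b - a) ^ 3 = β • (b - a) ∧
    (∀ x : KAlg K α1 α2, y ^ 3 * x = x * y ^ 3) := by
  intro a b c y β
  have rel {f g} (h : KRel K α1 α2 f g) := RingQuot.mkAlgHom_rel K h
  have haa : a * a = algebraMap K _ α1 := by
    simpa only [Ka, a, map_mul, AlgHom.commutes] using rel .ra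
  have hbb : b * b = algebraMap K _ α1 := by
    simpa only [Kb, b, map_mul, AlgHom.commutes] using rel .rb
  have hcc : c * c = algebraMap K _ α1 := by
    simpa only [Kc, c, map_mul, AlgHom.commutes] using rel .rc
  have h1 : a * b + b * c + c * a = algebraMap K _ α2 := by
    simpa only [a, b, c, Ka, Kb, Kc, map_mul, map_add, AlgHom.commutes] using rel .r1
  have h2 : a * c + c * b + b * a = algebraMap K _ α2 + y := by
    simpa only [a, b, c, y, Ka, Kb, Kc, Ky, map_mul, map_add, AlgHom.commutes] using rel .r2
  have hac := mul_mul_sub_mul_mul_eq_smul haa hcc h1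
  have hba := mul_mul_sub_mul_mul_eq_smul hbb haa (by rw [← h1]; abel : b * c + c * a + a * b = _)
  have hcb := mul_mul_sub_mul_mul_eq_smul hcc hbb (by rw [← h1]; abel : c * a + a * b + b * c = _)
  have hya : y * a = c * y := mul_eq_mul_of_eq_add haa hcc h2 hac
  have hyb : y * b = a * y :=
    mul_eq_mul_of_eq_add hbb haa (by rw [← h2]; abel : b * a + a * c + c * b = _) hba
  have hyc : y * c = b * y :=
    mul_eq_mul_of_eq_add hcc hbb (by rw [← h2]; abel : c * b + b * a + a * c = _) hcb
  exact ⟨hya, hyb, hyc, hba, sub_pow_three_eq_smul haa hbb hba,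
    KAlg_commute (commute_pow_three hya hyc hyb) (commute_pow_three hyb hya hyc)
      (commute_pow_three hyc hyb hya) (Commute.pow_self y 3)⟩
end
end

section
/- Let α1, α2 ∈ K, β = 3α1 − α2, and let ζ ∈ K satisfy ζ² + ζ + 1 = 0. In 𝒦(α1,α2) set t = a + b + c, v₊ = a + ζ·b + ζ²·c, v₋ = a + ζ²·b + ζ·c. Then y·v₊ = ζ·v₊·y, y·v₋ = ζ²·v₋·y, v₊·v₋ = β + ζ·y, v₋·v₊ = β + ζ²·y, t·v₊ = −v₊·t − v₋², and t·v₋ = −v₋·t − v₊². -/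
noncomputable section

open FreeAlgebra

/-- In an algebra satisfying the relations of `𝒦(α₁, α₂)`, moving `y` past a generator permutes
the generators cyclically. -/
theorem cyclic_comm_of_relations {K A : Type*} [CommRing K] [Ring A] [Algebra K A] {α1 α2 : K}
    {a b c y : A} (ha : a * a = α1 • (1 : A))
    (hc : c * c = α1 • (1 : A)) (h1 : a * b + b * c + c * a = α2 • (1 : A))
    (h2 : a * c + c * b + b * a = α2 • (1 : A) + y) : y * a = c * y := by
  have hy : y = a * c + c * b + b * a - α2 • (1 : A) := by rw [h2]; abel
  have e1 := congrArg (a * ·) h1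
  have e2 := congrArg (· * c) h1
  have f1 : b * a * a = α1 • b := by rw [mul_assoc, ha, mul_smul_comm, mul_one]
  have f2 : c * (c * b) = α1 • b := by rw [← mul_assoc, hc, smul_mul_assoc, one_mul]
  have f3 : a * (a * b) = α1 • b := by rw [← mul_assoc, ha, smul_mul_assoc, one_mul]
  have f4 : b * c * c = α1 • b := by rw [mul_assoc, hc, mul_smul_comm, mul_one]
  simp only [mul_add, add_mul, mul_smul_comm, smul_mul_assoc, mul_one, one_mul, f3, f4] at e1 e2
  rw [hy]
  simp only [mul_add, add_mul, mul_sub, sub_mul, mul_smul_comm, smul_mul_assoc, mul_one, one_mul,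
    f1, f2]
  simp only [mul_assoc] at e1 e2 ⊢
  linear_combination (norm := module) e1 - e2

theorem KAlg_u1v1 (K : Type) [Field K] [IsAlgClosed K]
    (h2 : ringChar K ≠ 2) (h3 : ringChar K ≠ 3) (α1 α2 : K)
    (ζ : K) (hζ : ζ ^ 2 + ζ + 1 = 0) :
    let a := Ka K α1 α2
    let b := Kb K α1 α2
    let c := Kc K α1 α2
    let y := Ky K α1 α2
    let β := 3 * α1 - α2
    let t := a + b + c
    let vp := a + ζ • b + ζ ^ 2 • c
    let vm := a + ζ ^ 2 • b + ζ • c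
    y * vp = ζ • (vp * y) ∧ y * vm = ζ ^ 2 • (vm * y) ∧
    vp * vm = algebraMap K (KAlg K α1 α2) β + ζ • y ∧
    vm * vp = algebraMap K (KAlg K α1 α2) β + ζ ^ 2 • y ∧
    t * vp = -(vp * t) - vm ^ 2 ∧
    t * vm = -(vm * t) - vp ^ 2 := by
  intro a b c y β t vp vm
  have ha : a * a = α1 • (1 : KAlg K α1 α2) := by
    simpa [Algebra.algebraMap_eq_smul_one, a, Ka] using
      RingQuot.mkAlgHom_rel K (KRel.ra (α1 := α1) (α2 := α2))
  have hb : b * b = α1 • (1 : KAlg K α1 α2) := by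
    simpa [Algebra.algebraMap_eq_smul_one, b, Kb] using
      RingQuot.mkAlgHom_rel K (KRel.rb (α1 := α1) (α2 := α2))
  have hc : c * c = α1 • (1 : KAlg K α1 α2) := by
    simpa [Algebra.algebraMap_eq_smul_one, c, Kc] using
      RingQuot.mkAlgHom_rel K (KRel.rc (α1 := α1) (α2 := α2))
  have h1 : a * b + b * c + c * a = α2 • (1 : KAlg K α1 α2) := by
    simpa [Algebra.algebraMap_eq_smul_one, a, b, c, Ka, Kb, Kc] using
      RingQuot.mkAlgHom_rel K (KRel.r1 (α1 := α1) (α2 := α2))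
  have h2 : a * c + c * b + b * a = α2 • (1 : KAlg K α1 α2) + y := by
    simpa [Algebra.algebraMap_eq_smul_one, a, b, c, y, Ka, Kb, Kc, Ky] using
      RingQuot.mkAlgHom_rel K (KRel.r2 (α1 := α1) (α2 := α2))
  clear_value a b c y
  have hya : y * a = c * y := cyclic_comm_of_relations ha hc h1 h2
  have hyb : y * b = a * y :=
    cyclic_comm_of_relations hb ha (by rw [← h1]; abel) (by rw [← h2]; abel)
  have hyc : y * c = b * y :=
    cyclic_comm_of_relations hc hb (by rw [← h1]; abel) (by rw [← h2]; abel)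
  have hy : y = a * c + c * b + b * a - α2 • (1 : KAlg K α1 α2) := by rw [h2]; abel
  have hca : c * a = α2 • (1 : KAlg K α1 α2) - a * b - b * c := by rw [← h1]; abel
  refine ⟨?_, ?_, ?_, ?_, ?_, ?_⟩
  · simp only [vp, mul_add, add_mul, mul_smul_comm, smul_mul_assoc, hya, hyb, hyc]
    match_scalars <;> grind
  · simp only [vm, mul_add, add_mul, mul_smul_comm, smul_mul_assoc, hya, hyb, hyc]
    match_scalars <;> grind
  · simp only [vp, vm, β, Algebra.algebraMap_eq_smul_one, hy, mul_add, add_mul, mul_smul_comm,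
      smul_mul_assoc, ha, hb, hc, hca]
    match_scalars <;> grind
  · simp only [vp, vm, β, Algebra.algebraMap_eq_smul_one, hy, mul_add, add_mul, mul_smul_comm,
      smul_mul_assoc, ha, hb, hc, hca]
    match_scalars <;> grind
  · simp only [t, vp, vm, pow_two (_ + _), mul_add, add_mul, mul_smul_comm, smul_mul_assoc,
      ha, hb, hc]
    match_scalars <;> grind
  · simp only [t, vp, vm, pow_two (_ + _), mul_add, add_mul, mul_smul_comm, smul_mul_assoc,
      ha, hb, hc]
    match_scalars <;> grind
end
end

section
/- Let α1, α2 ∈ K, β = 3α1 − α2, and let ζ ∈ K satisfy ζ² + ζ + 1 = 0. In 𝒦(α1,α2) set t = a + b + c, v₊ = a + ζ·b + ζ²·c, v₋ = a + ζ²·b + ζ·c. Then t² = y + 3α1 + 2α2, t·v₊³ + v₊³·t = 2y² − 2β·y − β², v₊⁶ = y³ + β³, and v₊³ = v₋³. -/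
noncomputable section

open FreeAlgebra

section FourierRelations

variable {K A : Type*} [Field K] [Ring A] [Algebra K A] {ζ β : K} {t u v y : A}

/-- The two expressions of `u * v * u` give a `ζ`-commutation of `y` with `u`. -/
theorem mul_comm_smul_of_mul_eq (hζ : ζ ^ 2 + ζ + 1 = 0)
    (huv : u * v = β • (1 : A) + ζ • y) (hvu : v * u = β • (1 : A) + ζ ^ 2 • y) :
    u * y = ζ ^ 2 • (y * u) := by
  have h3 : ζ ^ 3 = 1 := by linear_combination (ζ - 1) * hζ
  have h : u * v * u = u * (v * u) := mul_assoc u v u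
  rw [huv, hvu] at h
  simp only [mul_add, add_mul, smul_mul_assoc, mul_smul_comm, one_mul, mul_one] at h
  have h' : ζ • (y * u) = ζ ^ 2 • (u * y) := add_left_cancel h
  calc u * y = ζ • ζ ^ 2 • (u * y) := by
        rw [smul_smul, ← pow_succ', h3, one_smul]
    _ = ζ ^ 2 • (y * u) := by rw [← h', smul_smul, ← pow_two]

theorem cube_eq_cube_of_sq_eq (hty : Commute t y)
    (huv : u * v = β • (1 : A) + ζ • y)
    (hu : u * u = -(t * v + v * t)) (hv : v * v = -(t * u + u * t)) :
    u ^ 3 = v ^ 3 := by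
  have h1 : u ^ 3 = -(u * t * v + u * v * t) := by
    rw [pow_three, hu]; noncomm_ring
  have h2 : v ^ 3 = -(t * (u * v) + u * t * v) := by
    rw [pow_three', hv]; noncomm_ring
  rw [h1, h2, huv]
  simp only [mul_add, add_mul, smul_mul_assoc, mul_smul_comm, one_mul, mul_one, hty.eq]
  abel

theorem sq_mul_sq_of_mul_eq (hζ : ζ ^ 2 + ζ + 1 = 0)
    (huv : u * v = β • (1 : A) + ζ • y) (huy : u * y = ζ ^ 2 • (y * u)) :
    u * u * (v * v) = (β • (1 : A) + y) * (β • (1 : A) + ζ • y) := by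
  have h3 : ζ * ζ ^ 2 = 1 := by linear_combination (ζ - 1) * hζ
  have h : u * (β • (1 : A) + ζ • y) = (β • (1 : A) + y) * u := by
    simp only [mul_add, add_mul, smul_mul_assoc, mul_smul_comm, one_mul, mul_one, huy, smul_smul,
      h3, one_smul]
  calc u * u * (v * v) = u * (u * v) * v := by noncomm_ring
    _ = (β • (1 : A) + y) * (β • (1 : A) + ζ • y) := by rw [huv, h, mul_assoc, huv]

theorem mul_cube_add_cube_mul (hζ : ζ ^ 2 + ζ + 1 = 0)
    (huv : u * v = β • (1 : A) + ζ • y) (hvu : v * u = β • (1 : A) + ζ ^ 2 • y)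
    (huy : u * y = ζ ^ 2 • (y * u)) (hvy : v * y = (ζ ^ 2) ^ 2 • (y * v))
    (hv : v * v = -(t * u + u * t)) :
    t * u ^ 3 + u ^ 3 * t = 2 • y ^ 2 - (2 * β) • y - (β ^ 2) • (1 : A) := by
  have hζ' : (ζ ^ 2) ^ 2 + ζ ^ 2 + 1 = 0 := by linear_combination (ζ ^ 2 - ζ + 1) * hζ
  have h : t * u ^ 3 + u ^ 3 * t =
      u * v * (v * u) - v * v * (u * u) - u * u * (v * v) := by
    have e : u * v * (v * u) = u * (v * v) * u := by noncomm_ring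
    rw [e, hv]; noncomm_ring
  rw [h, sq_mul_sq_of_mul_eq hζ huv huy, sq_mul_sq_of_mul_eq hζ' hvu hvy, huv, hvu]
  simp only [mul_add, add_mul, smul_mul_assoc, mul_smul_comm, one_mul, mul_one, ← pow_two]
  match_scalars
  · ring
  · ring
  · linear_combination (ζ - 2) * hζ

theorem cube_mul_cube_of_mul_eq (hζ : ζ ^ 2 + ζ + 1 = 0)
    (huv : u * v = β • (1 : A) + ζ • y) (huy : u * y = ζ ^ 2 • (y * u)) :
    u ^ 3 * v ^ 3 = y ^ 3 + (β ^ 3) • (1 : A) := by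
  have e : u ^ 3 * v ^ 3 = u * (u * u * (v * v)) * v := by noncomm_ring
  have h3 : ζ ^ 3 = 1 := by linear_combination (ζ - 1) * hζ
  have h1 : u * (β • (1 : A) + y) = (β • (1 : A) + ζ ^ 2 • y) * u := by
    simp only [mul_add, add_mul, smul_mul_assoc, mul_smul_comm, one_mul, mul_one, huy]
  have h2 : u * (β • (1 : A) + ζ • y) = (β • (1 : A) + y) * u := by
    simp only [mul_add, add_mul, smul_mul_assoc, mul_smul_comm, one_mul, mul_one, huy, smul_smul,
      ← pow_succ', h3, one_smul]
  rw [e, sq_mul_sq_of_mul_eq hζ huv huy, ← mul_assoc u, h1, mul_assoc _ u, h2, mul_assoc,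
    mul_assoc, huv]
  simp only [mul_add, add_mul, smul_mul_assoc, mul_smul_comm, one_mul, mul_one, pow_three]
  match_scalars
  · ring
  · linear_combination β ^ 2 * hζ
  · linear_combination β * ζ * hζ
  · linear_combination h3

end FourierRelations

theorem Ka_mul_self (K : Type) [Field K] (α1 α2 : K) :
    Ka K α1 α2 * Ka K α1 α2 = α1 • 1 := by
  simpa [Ka, Algebra.algebraMap_eq_smul_one] using
    RingQuot.mkAlgHom_rel K (KRel.ra (K := K) (α1 := α1) (α2 := α2))

theorem Kb_mul_self (K : Type) [Field K] (α1 α2 : K) :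
    Kb K α1 α2 * Kb K α1 α2 = α1 • 1 := by
  simpa [Kb, Algebra.algebraMap_eq_smul_one] using
    RingQuot.mkAlgHom_rel K (KRel.rb (K := K) (α1 := α1) (α2 := α2))

theorem Kc_mul_self (K : Type) [Field K] (α1 α2 : K) :
    Kc K α1 α2 * Kc K α1 α2 = α1 • 1 := by
  simpa [Kc, Algebra.algebraMap_eq_smul_one] using
    RingQuot.mkAlgHom_rel K (KRel.rc (K := K) (α1 := α1) (α2 := α2))

theorem Kab_add_Kbc_add_Kca (K : Type) [Field K] (α1 α2 : K) :
    Ka K α1 α2 * Kb K α1 α2 + Kb K α1 α2 * Kc K α1 α2 + Kc K α1 α2 * Ka K α1 α2 = α2 • 1 := by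
  simpa [Ka, Kb, Kc, Algebra.algebraMap_eq_smul_one] using
    RingQuot.mkAlgHom_rel K (KRel.r1 (K := K) (α1 := α1) (α2 := α2))

theorem Kac_add_Kcb_add_Kba (K : Type) [Field K] (α1 α2 : K) :
    Ka K α1 α2 * Kc K α1 α2 + Kc K α1 α2 * Kb K α1 α2 + Kb K α1 α2 * Ka K α1 α2 =
      α2 • 1 + Ky K α1 α2 := by
  simpa [Ka, Kb, Kc, Ky, Algebra.algebraMap_eq_smul_one] using
    RingQuot.mkAlgHom_rel K (KRel.r2 (K := K) (α1 := α1) (α2 := α2))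

theorem KAlg_uv (K : Type) [Field K] [IsAlgClosed K]
    (h2 : ringChar K ≠ 2) (h3 : ringChar K ≠ 3) (α1 α2 : K)
    (ζ : K) (hζ : ζ ^ 2 + ζ + 1 = 0) :
    let a := Ka K α1 α2
    let b := Kb K α1 α2
    let c := Kc K α1 α2
    let y := Ky K α1 α2
    let β := 3 * α1 - α2
    let t := a + b + c
    let vp := a + ζ • b + ζ ^ 2 • c
    let vm := a + ζ ^ 2 • b + ζ • c
    t ^ 2 = y + algebraMap K (KAlg K α1 α2) (3 * α1 + 2 * α2) ∧
    t * vp ^ 3 + vp ^ 3 * t =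
      2 • y ^ 2 - (2 * β) • y - algebraMap K (KAlg K α1 α2) (β ^ 2) ∧
    vp ^ 6 = y ^ 3 + algebraMap K (KAlg K α1 α2) (β ^ 3) ∧
    vp ^ 3 = vm ^ 3 := by
  intro a b c y β t vp vm
  have ha : a * a = α1 • 1 := Ka_mul_self K α1 α2
  have hb : b * b = α1 • 1 := Kb_mul_self K α1 α2
  have hc : c * c = α1 • 1 := Kc_mul_self K α1 α2
  have h1 : a * b + b * c + c * a = α2 • 1 := Kab_add_Kbc_add_Kca K α1 α2
  have h2 : a * c + c * b + b * a = α2 • 1 + y := Kac_add_Kcb_add_Kba K α1 α2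
  clear_value a b c y
  have hca : c * a = α2 • 1 - a * b - b * c := by rw [← h1]; abel
  have hba : b * a = α2 • 1 + y - a * c - c * b := by rw [← h2]; abel
  have hζ' : (ζ ^ 2) ^ 2 + ζ ^ 2 + 1 = 0 := by linear_combination (ζ ^ 2 - ζ + 1) * hζ
  have ht : t ^ 2 = y + algebraMap K (KAlg K α1 α2) (3 * α1 + 2 * α2) := by
    simp only [t, pow_two, mul_add, add_mul, ha, hb, hc, hca, hba,
      Algebra.algebraMap_eq_smul_one]
    module
  have huv : vp * vm = β • 1 + ζ • y := by
    simp only [vp, vm, β, mul_add, add_mul, smul_mul_assoc, mul_smul_comm, ha, hb, hc, hca, hba]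
    match_scalars <;> grind
  have hvu : vm * vp = β • 1 + ζ ^ 2 • y := by
    simp only [vp, vm, β, mul_add, add_mul, smul_mul_assoc, mul_smul_comm, ha, hb, hc, hca, hba]
    match_scalars <;> grind
  have hu : vp * vp = -(t * vm + vm * t) := by
    simp only [t, vp, vm, mul_add, add_mul, smul_mul_assoc, mul_smul_comm, ha, hb, hc, hca, hba]
    match_scalars <;> grind
  have hv : vm * vm = -(t * vp + vp * t) := by
    simp only [t, vp, vm, mul_add, add_mul, smul_mul_assoc, mul_smul_comm, ha, hb, hc, hca, hba]
    match_scalars <;> grind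
  have hty : Commute t y := by
    rw [← sub_eq_iff_eq_add.mpr ht]
    exact ((Commute.refl t).pow_right 2).sub_right (Algebra.commutes _ t).symm
  have huy := mul_comm_smul_of_mul_eq hζ huv hvu
  have hvy : vm * y = (ζ ^ 2) ^ 2 • (y * vm) := by
    refine mul_comm_smul_of_mul_eq (u := vm) (v := vp) (β := β) hζ' hvu ?_
    rw [huv]
    congr 2
    linear_combination (ζ - ζ ^ 2) * hζ
  have huv3 := cube_eq_cube_of_sq_eq hty huv hu hv
  refine ⟨ht, ?_, ?_, huv3⟩
  · rw [Algebra.algebraMap_eq_smul_one]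
    exact mul_cube_add_cube_mul hζ huv hvu huy hvy hv
  · rw [Algebra.algebraMap_eq_smul_one, ← cube_mul_cube_of_mul_eq hζ huv huy, ← huv3, ← pow_add]
end
end
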